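/- Tauberian theorem at infinity: let v : [0,∞) → [0,∞) be a measurable function which is increasing for all sufficiently large t, and set f(s) = ∫₀^∞ x^{−s} v(x) dx. Assume the integral defining f(s) converges absolutely for all complex s with Re(s) sufficiently large, and that there exist a ∈ ℝ, a positive integer b, δ₀ > 0 and κ > 0 such that f admits a meromorphic continuation to the half-plane {Re(s) > a − δ₀} whose unique pole in this half-plane is s = a, of multiplicity b, and which satisfies the bound |f(s)·(s−a)^b / s^b| = O((1+|Im(s)|)^κ) on this half-plane. Then there exist a nonzero polynomial P and δ > 0 such that v(t) = t^{a−1}·P(log t) + O(t^{a−1−δ}) as t → ∞. -/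

import Mathlib

open MeasureTheory Filter Set Complex
open scoped ENNReal NNReal

lemma holo_exp (μ : Measure ℝ) (X w : ℝ → ℝ) (hw : Measurable w) (hw0 : ∀ᵐ x ∂μ, 0 ≤ w x)
    (S : Set ℝ) (hS : IsOpen S)
    (hint : ∀ σ ∈ S, Integrable (fun x => w x * Real.exp (σ * X x)) μ) :
    DifferentiableOn ℂ (fun z : ℂ => ∫ x, (w x : ℂ) * cexp (z * X x) ∂μ) {z | z.re ∈ S} := by
  set ν := μ.withDensity (fun x => ((Real.toNNReal (w x) : ℝ≥0) : ℝ≥0∞)) with hν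
  have hm : Measurable (fun x => Real.toNNReal (w x)) := hw.real_toNNReal
  have h1 : ∀ z : ℂ, (∫ x, (w x : ℂ) * cexp (z * X x) ∂μ) = ProbabilityTheory.complexMGF X ν z := by
    intro z
    rw [ProbabilityTheory.complexMGF, hν, integral_withDensity_eq_integral_smul hm]
    apply integral_congr_ae
    filter_upwards [hw0] with x hx
    rw [NNReal.smul_def, Real.coe_toNNReal _ hx, Complex.real_smul]
  have h2 : S ⊆ interior (ProbabilityTheory.integrableExpSet X ν) := by
    apply interior_maximal _ hS
    intro σ hσ
    show Integrable _ _
    rw [hν, integrable_withDensity_iff_integrable_smul hm]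
    refine (hint σ hσ).congr ?_
    filter_upwards [hw0] with x hx
    rw [NNReal.smul_def, Real.coe_toNNReal _ hx, smul_eq_mul]
  simp_rw [h1]
  intro z hz
  exact (ProbabilityTheory.analyticAt_complexMGF (h2 hz)).differentiableAt.differentiableWithinAt

lemma cs_int (g : ℝ → ℂ) (hg : Continuous g) (hc : HasCompactSupport g) (h : ℝ → ℂ)
    (hh : Continuous h) : Integrable (fun y => g y * h y) :=
  (hg.mul hh).integrable_of_hasCompactSupport hc.mul_right

lemma bump_decay (N : ℕ) (A : ℝ) : ∀ (g : ℝ → ℂ), ContDiff ℝ (⊤ : ℕ∞) g → HasCompactSupport g →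
    ∃ C : ℝ, 0 ≤ C ∧ ∀ z : ℂ, |z.re| ≤ A →
      (1 + ‖z‖) ^ N * ‖∫ y : ℝ, g y * cexp (-z * y)‖ ≤ C := by
  induction N with
  | zero =>
    intro g hg hc
    refine ⟨∫ y, ‖g y * (Real.exp (A * |y|) : ℂ)‖, by positivity, fun z hz => ?_⟩
    rw [pow_zero, one_mul]
    refine (norm_integral_le_integral_norm _).trans ?_
    apply integral_mono
    · exact (cs_int g hg.continuous hc _ (by fun_prop)).norm
    · exact (cs_int g hg.continuous hc (fun y => (Real.exp (A * |y|) : ℂ)) (by fun_prop)).norm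
    · intro y
      simp only [norm_mul]
      gcongr
      rw [Complex.norm_exp, Complex.norm_real, Real.norm_eq_abs, abs_of_pos (Real.exp_pos _)]
      apply Real.exp_le_exp.2
      have : (-z * (y : ℂ)).re = -(z.re * y) := by simp
      rw [this]
      calc -(z.re * y) ≤ |z.re * y| := neg_le_abs _
        _ = |z.re| * |y| := abs_mul _ _
        _ ≤ _ := by gcongr
  | succ N ih =>
    intro g hg hc
    have hg' : ContDiff ℝ (⊤ : ℕ∞) (deriv g) := by
      have := (contDiff_infty_iff_deriv (𝕜 := ℝ) (f := g)).1 hg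
      exact this.2
    obtain ⟨C1, h1, H1⟩ := ih g hg hc
    obtain ⟨C2, h2, H2⟩ := ih (deriv g) hg' hc.deriv
    refine ⟨C1 + C2, by positivity, fun z hz => ?_⟩
    have key : ∫ y : ℝ, deriv g y * cexp (-z * y) = z * ∫ y : ℝ, g y * cexp (-z * y) := by
      have hd : ∀ x : ℝ, HasDerivAt (fun y : ℝ => cexp (-z * y)) (cexp (-z * x) * (-z)) x := by
        intro x
        have : HasDerivAt (fun y : ℝ => -z * (y : ℂ)) (-z) x := by
          simpa using (Complex.ofRealCLM.hasDerivAt (x := x)).const_mul (-z)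
        exact this.cexp
      have := integral_mul_deriv_eq_deriv_mul_of_integrable (u := g) (u' := deriv g)
        (v := fun y : ℝ => cexp (-z * y)) (v' := fun x : ℝ => cexp (-z * x) * (-z))
        (fun x _ => (hg.differentiable (by simp) x).hasDerivAt) (fun x _ => hd x)
        (cs_int g hg.continuous hc _ (by fun_prop))
        (cs_int _ hg'.continuous hc.deriv _ (by fun_prop))
        (cs_int g hg.continuous hc _ (by fun_prop))
      have h3 : ∫ (x : ℝ), deriv g x * cexp (-z * x) = - ∫ (x : ℝ), g x * (cexp (-z * x) * (-z)) := by
        rw [this, neg_neg]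
      rw [h3, ← integral_const_mul, ← integral_neg]
      congr 1; ext y; ring
    have e2 := H2 z hz
    rw [key, norm_mul] at e2
    have e1 := H1 z hz
    calc _ = (1 + ‖z‖) ^ N * ‖∫ y : ℝ, g y * cexp (-z * y)‖ +
        (1 + ‖z‖) ^ N * (‖z‖ * ‖∫ y : ℝ, g y * cexp (-z * y)‖) := by ring
      _ ≤ _ := add_le_add e1 e2

lemma exists_bump : ∃ φ : ℝ → ℝ, ContDiff ℝ (⊤ : ℕ∞) φ ∧ HasCompactSupport φ ∧ (∀ y, 0 ≤ φ y) ∧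
    (∀ y, |y| ≤ 1/2 → φ y = 1) ∧ (∀ y, 1 ≤ |y| → φ y = 0) := by
  let f : ContDiffBump (0:ℝ) := ⟨1/2, 1, by norm_num, by norm_num⟩
  refine ⟨f, f.contDiff, f.hasCompactSupport, fun y => f.nonneg, fun y hy => ?_, fun y hy => ?_⟩
  · apply f.one_of_mem_closedBall; simpa [f] using hy
  · apply f.zero_of_le_dist; simpa using hy

lemma bump_holo (φ : ℝ → ℝ) (hφ : ContDiff ℝ (⊤ : ℕ∞) φ) (hc : HasCompactSupport φ)
    (h0 : ∀ y, 0 ≤ φ y) :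
    Differentiable ℂ (fun z : ℂ => ∫ y : ℝ, (φ y : ℂ) * cexp (-z * y)) := by
  have := holo_exp volume (fun y => -y) φ hφ.continuous.measurable (Eventually.of_forall h0)
    univ isOpen_univ (fun σ _ => by
      refine Continuous.integrable_of_hasCompactSupport ?_ hc.mul_right
      exact hφ.continuous.mul (by fun_prop))
  intro z
  have h := (this z (mem_univ _)).differentiableAt (by simp)
  refine h.congr_of_eventuallyEq (Eventually.of_forall fun z => ?_)
  refine integral_congr_ae (Eventually.of_forall fun y => ?_)
  simp

lemma int_of_bound (g : ℝ → ℂ) (hg : Continuous g) (C : ℝ)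
    (h : ∀ y, ‖g y‖ ≤ C * (1 + y ^ 2)⁻¹) : Integrable g :=
  (integrable_inv_one_add_sq.const_mul C).mono' hg.aestronglyMeasurable (Eventually.of_forall h)

lemma Psi_bound (Φ : ℂ → ℂ) (N : ℕ) (A : ℝ) (C : ℝ)
    (hΦ : ∀ z : ℂ, |z.re| ≤ A → (1 + ‖z‖) ^ N * ‖Φ z‖ ≤ C) (ε : ℝ) (hε : 0 < ε) (hε1 : ε ≤ 1)
    (s : ℂ) (hs : |s.re| ≤ A) : (1 + |s.im|) ^ N * ‖Φ (ε * s)‖ ≤ C / ε ^ N := by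
  have h1 := hΦ (ε * s) (by
    rw [Complex.re_ofReal_mul, abs_mul, abs_of_pos hε]
    nlinarith [abs_nonneg s.re])
  rw [le_div_iff₀ (by positivity)]
  refine le_trans ?_ h1
  have h2 : ε * (1 + |s.im|) ≤ 1 + ‖(ε : ℂ) * s‖ := by
    rw [norm_mul, Complex.norm_real, Real.norm_eq_abs, abs_of_pos hε]
    have := Complex.abs_im_le_norm s
    nlinarith
  calc _ = (ε * (1 + |s.im|)) ^ N * ‖Φ (ε * s)‖ := by rw [mul_pow]; ring
    _ ≤ _ := by gcongr

lemma bump_inversion (φ : ℝ → ℝ) (hφ : ContDiff ℝ (⊤ : ℕ∞) φ) (hc : HasCompactSupport φ)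
    (h0 : ∀ y, 0 ≤ φ y) (Φ : ℂ → ℂ) (hΦ : Φ = fun z : ℂ => ∫ y : ℝ, (φ y : ℂ) * cexp (-z * y))
    (c U ε : ℝ) (hε : 0 < ε) (hε1 : ε ≤ 1) :
    Integrable (fun ξ : ℝ => ε * cexp ((c + (-2 * Real.pi * ξ : ℝ) * I) * U) *
        Φ (ε * (c + (-2 * Real.pi * ξ : ℝ) * I))) ∧
    ∀ u : ℝ, (φ ((U - u) / ε) : ℂ) = ∫ ξ : ℝ, cexp (-(c + (-2 * Real.pi * ξ : ℝ) * I) * u) *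
      (ε * cexp ((c + (-2 * Real.pi * ξ : ℝ) * I) * U) *
        Φ (ε * (c + (-2 * Real.pi * ξ : ℝ) * I))) := by
  have hΦd : Differentiable ℂ Φ := hΦ ▸ bump_holo φ hφ hc h0
  have hφc : Continuous φ := hφ.continuous
  set h : ℝ → ℂ := fun u => (φ ((U - u) / ε) : ℂ) * cexp (c * u) with hh
  have hcs : HasCompactSupport (fun u => (φ ((U - u) / ε) : ℂ)) := by
    have e : (fun u => (φ ((U - u) / ε) : ℂ)) = (fun y => (φ y : ℂ)) ∘
        ((Homeomorph.subLeft U).trans (Homeomorph.mulRight₀ ε⁻¹ (by positivity))) := by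
      ext u; simp [div_eq_mul_inv]
    rw [e]
    exact HasCompactSupport.comp_homeomorph (hc.comp_left (g := fun x : ℝ => (x : ℂ)) (by simp)) _
  have hcont : Continuous h := by
    rw [hh]
    refine Continuous.mul ?_ (by fun_prop)
    exact Complex.continuous_ofReal.comp (hφc.comp (by fun_prop))
  have hint : Integrable h := hcont.integrable_of_hasCompactSupport hcs.mul_right
  have hF : FourierTransform.fourier h = fun ξ : ℝ =>
      ε * cexp ((c + (-2 * Real.pi * ξ : ℝ) * I) * U) *
        Φ (ε * (c + (-2 * Real.pi * ξ : ℝ) * I)) := by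
    ext ξ
    rw [Real.fourier_eq']
    set s : ℂ := c + (-2 * Real.pi * ξ : ℝ) * I with hs
    let g : ℝ → ℂ := fun y => (φ y : ℂ) * cexp (s * (U - ε * y))
    have e1 : ∀ u : ℝ, cexp ((-2 * Real.pi * inner ℝ u ξ : ℝ) * I) • h u = g ((U - u) / ε) := by
      intro u
      simp only [hh, g, smul_eq_mul]
      rw [mul_left_comm, ← Complex.exp_add]
      congr 2
      have : (ε : ℂ) ≠ 0 := by exact_mod_cast hε.ne'
      simp only [RCLike.inner_apply, conj_trivial, hs]
      push_cast
      field_simp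
      ring
    have e2 : ∫ u : ℝ, g ((U - u) / ε) = ε * ∫ y, g y := by
      rw [integral_sub_left_eq_self (fun w => g (w / ε)) volume U, Measure.integral_comp_div,
        abs_of_pos hε, Complex.real_smul]
    refine (integral_congr_ae (Eventually.of_forall e1)).trans ?_
    rw [e2, hΦ, mul_assoc]
    congr 1
    simp only [g]
    rw [← integral_const_mul]
    congr 1; ext y
    rw [mul_left_comm, ← Complex.exp_add]
    congr 2; ring
  have hFi : Integrable (FourierTransform.fourier h) := by
    obtain ⟨C, hC0, hC⟩ := bump_decay 2 |c| (fun y => (φ y : ℂ))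
      (Complex.ofRealCLM.contDiff.comp hφ) (hc.comp_left (g := fun x : ℝ => (x : ℂ)) (by simp))
    rw [hF]
    apply int_of_bound _ _ (ε * Real.exp (c * U) * (C / ε ^ 2))
    · intro ξ
      have hb := Psi_bound Φ 2 |c| C (by rw [hΦ]; exact hC) ε hε hε1
        (c + (-2 * Real.pi * ξ : ℝ) * I) (by simp)
      have him : ((c : ℂ) + (-2 * Real.pi * ξ : ℝ) * I).im = -2 * Real.pi * ξ := by simp
      have hre : (((c : ℂ) + (-2 * Real.pi * ξ : ℝ) * I) * U).re = c * U := by simp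
      rw [him] at hb
      rw [norm_mul, norm_mul, Complex.norm_exp, hre, Complex.norm_real, Real.norm_eq_abs,
        abs_of_pos hε, mul_assoc (ε * Real.exp (c * U))]
      gcongr
      rw [← div_eq_mul_inv, le_div_iff₀ (by positivity)]
      refine le_trans ?_ hb
      rw [mul_comm]
      gcongr
      have h3 : |-2 * Real.pi * ξ| = 2 * Real.pi * |ξ| := by
        rw [abs_mul, abs_mul, abs_of_pos Real.pi_pos]; simp
      rw [h3]
      have h4 : |ξ| ≤ 2 * Real.pi * |ξ| := by
        nlinarith [Real.pi_gt_three, abs_nonneg ξ]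
      rw [← sq_abs ξ]
      nlinarith [abs_nonneg ξ]
    · refine Continuous.mul (by fun_prop) (hΦd.continuous.comp (by fun_prop))
  rw [hF] at hFi
  refine ⟨hFi, fun u => ?_⟩
  have hinv := congrFun (hcont.fourierInv_fourier_eq hint (hF ▸ hFi)) u
  rw [hF, Real.fourierInv_eq'] at hinv
  have e3 : (φ ((U - u) / ε) : ℂ) = cexp (-(c * u)) * h u := by
    simp only [hh]
    rw [mul_left_comm, ← Complex.exp_add]; simp
  rw [e3, ← hinv, ← integral_const_mul]
  congr 1; ext ξ
  rw [smul_eq_mul, ← mul_assoc, ← Complex.exp_add]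
  congr 2
  simp only [RCLike.inner_apply, conj_trivial]
  push_cast; ring

lemma contour_shift (K : ℂ → ℂ) (c₁ c M : ℝ) (hcc : c₁ ≤ c)
    (hK : DifferentiableOn ℂ K {s | c₁ ≤ s.re ∧ s.re ≤ c})
    (hM : ∀ s : ℂ, c₁ ≤ s.re → s.re ≤ c → ‖K s‖ ≤ M * (1 + s.im ^ 2)⁻¹) :
    ∫ y : ℝ, K (c + y * I) = ∫ y : ℝ, K (c₁ + y * I) := by
  have hint : ∀ d : ℝ, c₁ ≤ d → d ≤ c → Integrable (fun y : ℝ => K (d + y * I)) := by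
    intro d h1 h2
    apply int_of_bound _ _ M
    · intro y
      simpa using hM (d + y * I) (by simpa using h1) (by simpa using h2)
    · apply hK.continuousOn.comp_continuous (by fun_prop)
      intro y; simp [h1, h2]
  have hT : ∀ d : ℝ, c₁ ≤ d → d ≤ c → Tendsto (fun T : ℝ => ∫ y in (-T)..T, K (d + y * I)) atTop
      (nhds (∫ y : ℝ, K (d + y * I))) := fun d h1 h2 =>
    intervalIntegral_tendsto_integral (hint d h1 h2) tendsto_neg_atTop_atBot tendsto_id
  have hrect : ∀ T : ℝ, (((∫ (x : ℝ) in c₁..c, K (x + (-T : ℝ) * I)) - ∫ (x : ℝ) in c₁..c, K (x + T * I)) +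
          I • ∫ (y : ℝ) in (-T)..T, K (c + y * I)) - I • ∫ (y : ℝ) in (-T)..T, K (c₁ + y * I) = 0 := by
    intro T
    have := Complex.integral_boundary_rect_eq_zero_of_differentiableOn K (c₁ + (-T : ℝ) * I) (c + T * I)
      (hK.mono (by
        intro s hs
        rw [Complex.mem_reProdIm] at hs
        have := hs.1
        simp [uIcc_of_le hcc] at this
        exact this))
    simpa using this
  have hz : ∀ σ : ℝ, |σ| = 1 → Tendsto (fun T : ℝ => ∫ (x : ℝ) in c₁..c, K (x + (σ * T : ℝ) * I)) atTop (nhds 0) := by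
    intro σ hσ
    have hσ2 : σ ^ 2 = 1 := by rw [← sq_abs, hσ]; norm_num
    refine squeeze_zero_norm (a := fun T => M * (1 + T ^ 2)⁻¹ * |c - c₁|) ?_ ?_
    · intro T
      apply intervalIntegral.norm_integral_le_of_norm_le_const
      intro x hx
      rw [uIoc_of_le hcc] at hx
      have := hM (x + (σ * T : ℝ) * I) (by simpa using hx.1.le) (by simpa using hx.2)
      simpa [mul_pow, hσ2] using this
    · have : Tendsto (fun T : ℝ => (1 + T ^ 2)⁻¹) atTop (nhds 0) := by
        apply Tendsto.inv_tendsto_atTop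
        exact tendsto_atTop_add_const_left _ _ (tendsto_pow_atTop (by norm_num))
      simpa using (this.const_mul M).mul_const |c - c₁|
  have hlim := (((hz (-1) (by simp)).sub (hz 1 (by simp))).add ((hT c hcc le_rfl).const_smul I)).sub
    ((hT c₁ le_rfl hcc).const_smul I)
  have h0 := tendsto_nhds_unique hlim (tendsto_const_nhds.congr (fun T => by
    have := hrect T
    simp only [neg_one_mul, one_mul]
    exact this.symm))
  have h1 : I * ((∫ y : ℝ, K (c + y * I)) - ∫ y : ℝ, K (c₁ + y * I)) = 0 := by
    rw [← h0]; simp only [smul_eq_mul]; ring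
  have h2 := (mul_eq_zero.1 h1).resolve_left I_ne_zero
  exact sub_eq_zero.1 h2

lemma smoothed_bound (φ : ℝ → ℝ) (hφ : ContDiff ℝ (⊤ : ℕ∞) φ) (hc : HasCompactSupport φ)
    (h0 : ∀ y, 0 ≤ φ y) (V : ℝ → ℂ) (c₁ c κ B : ℝ) (hcc : c₁ ≤ c) (hB : 0 ≤ B)
    (hV : IntegrableOn (fun x : ℝ => cexp (-c * Real.log x) * V x) (Ioi 0))
    (G : ℂ → ℂ) (hG : DifferentiableOn ℂ G {s | c₁ ≤ s.re ∧ s.re ≤ c})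
    (hGV : ∀ s : ℂ, s.re = c → G s = ∫ x in Ioi (0:ℝ), cexp (-s * Real.log x) * V x)
    (hGB : ∀ s : ℂ, c₁ ≤ s.re → s.re ≤ c → ‖G s‖ ≤ B * (1 + |s.im|) ^ κ) :
    ∃ (C : ℝ) (N : ℕ), 0 ≤ C ∧ ∀ t ε : ℝ, 1 ≤ t → 0 < ε → ε ≤ 1 →
      IntegrableOn (fun x : ℝ => V x * (φ ((Real.log t - Real.log x) / ε) : ℂ)) (Ioi 0) ∧
      ‖∫ x in Ioi (0:ℝ), V x * (φ ((Real.log t - Real.log x) / ε) : ℂ)‖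
        ≤ C * ε * t ^ c₁ / ε ^ N := by
  obtain ⟨N, hN⟩ : ∃ N : ℕ, κ + 2 ≤ N := exists_nat_ge _
  set Φ : ℂ → ℂ := fun z : ℂ => ∫ y : ℝ, (φ y : ℂ) * cexp (-z * y) with hΦ
  have hΦd : Differentiable ℂ Φ := hΦ ▸ bump_holo φ hφ hc h0
  set A := max |c₁| |c| with hA
  obtain ⟨D, hD0, hD⟩ := bump_decay N A (fun y => (φ y : ℂ))
      (Complex.ofRealCLM.contDiff.comp hφ) (hc.comp_left (g := fun x : ℝ => (x : ℂ)) (by simp))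
  refine ⟨(2 * Real.pi)⁻¹ * (D * B * Real.pi), N, by positivity, fun t ε ht hε hε1 => ?_⟩
  have ht0 : 0 < t := by linarith
  set U := Real.log t with hU
  set Ψ : ℂ → ℂ := fun s => ε * cexp (s * U) * Φ (ε * s) with hΨ
  obtain ⟨hi, hinv⟩ := bump_inversion φ hφ hc h0 Φ hΦ c U ε hε hε1
  set S : ℝ → ℂ := fun ξ => c + (-2 * Real.pi * ξ : ℝ) * I with hS
  have step0 : (fun x : ℝ => V x * (φ ((U - Real.log x) / ε) : ℂ)) =
      fun x => ∫ ξ : ℝ, (cexp (-(S ξ) * Real.log x) * V x) * Ψ (S ξ) := by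
    ext x
    rw [hinv (Real.log x), ← integral_const_mul]
    congr 1; ext ξ
    simp only [hΨ, hS]
    ring
  have hfub : Integrable (Function.uncurry fun (x : ℝ) (ξ : ℝ) =>
      (cexp (-(S ξ) * Real.log x) * V x) * Ψ (S ξ)) ((volume.restrict (Ioi (0:ℝ))).prod volume) := by
    have h1 := Integrable.mul_prod hV hi
    have hm : AEStronglyMeasurable (fun z : ℝ × ℝ => cexp ((2 * Real.pi * z.2 * Real.log z.1 : ℝ) * I))
        ((volume.restrict (Ioi (0:ℝ))).prod volume) := by
      apply Measurable.aestronglyMeasurable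
      have : Measurable (fun z : ℝ × ℝ => Real.log z.1) := Real.measurable_log.comp measurable_fst
      fun_prop
    refine (h1.bdd_mul (c := 1) hm (Eventually.of_forall fun z => ?_)).congr
      (Eventually.of_forall fun z => ?_)
    · exact (Complex.norm_exp_ofReal_mul_I _).le
    · simp only [Function.uncurry, hΨ, hS]
      have : cexp (-(c + ((-2 * Real.pi * z.2 : ℝ) : ℂ) * I) * (Real.log z.1 : ℂ)) =
          cexp ((2 * Real.pi * z.2 * Real.log z.1 : ℝ) * I) * cexp (-c * Real.log z.1) := by
        rw [← Complex.exp_add]; congr 1; push_cast; ring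
      rw [this]; ring
  refine ⟨by rw [step0]; exact hfub.integral_prod_left, ?_⟩
  have hK : (fun ξ : ℝ => ∫ x in Ioi (0:ℝ), (cexp (-(S ξ) * Real.log x) * V x) * Ψ (S ξ)) =
      fun ξ : ℝ => (fun y : ℝ => (fun s => G s * Ψ s) (c + y * I)) (-2 * Real.pi * ξ) := by
    ext ξ
    rw [integral_mul_const, ← hGV (S ξ) (by simp [hS])]
  have hb : ∀ s : ℂ, c₁ ≤ s.re → s.re ≤ c →
      ‖G s * Ψ s‖ ≤ (D * B * ε * t ^ s.re / ε ^ N) * (1 + s.im ^ 2)⁻¹ := by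
    intro s h1 h2
    have hP := Psi_bound Φ N A D hD ε hε hε1 s (by
      rw [hA]; exact abs_le_max_abs_abs h1 h2)
    have hre : (s * U).re = U * s.re := by simp [mul_comm]
    rw [norm_mul, hΨ, norm_mul, norm_mul, Complex.norm_exp, hre, Complex.norm_real, Real.norm_eq_abs,
        abs_of_pos hε, ← Real.rpow_def_of_pos ht0, ← div_eq_mul_inv, le_div_iff₀ (by positivity)]
    have h3 : (1 + |s.im|) ^ κ * (1 + s.im ^ 2) ≤ (1 + |s.im|) ^ N := by
      have hx : (1:ℝ) ≤ 1 + |s.im| := by linarith [abs_nonneg s.im]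
      calc (1 + |s.im|) ^ κ * (1 + s.im ^ 2) ≤ (1 + |s.im|) ^ κ * (1 + |s.im|) ^ (2:ℝ) := by
            gcongr
            rw [Real.rpow_two, ← sq_abs s.im]
            nlinarith [abs_nonneg s.im]
        _ = (1 + |s.im|) ^ (κ + 2) := by rw [Real.rpow_add (by linarith)]
        _ ≤ (1 + |s.im|) ^ (N:ℝ) := Real.rpow_le_rpow_of_exponent_le hx hN
        _ = _ := Real.rpow_natCast _ _
    calc ‖G s‖ * (ε * t ^ s.re * ‖Φ (ε * s)‖) * (1 + s.im ^ 2)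
        ≤ (B * (1 + |s.im|) ^ κ) * (ε * t ^ s.re * ‖Φ (ε * s)‖) * (1 + s.im ^ 2) := by
          gcongr; exact hGB s h1 h2
      _ = B * ε * t ^ s.re * (((1 + |s.im|) ^ κ * (1 + s.im ^ 2)) * ‖Φ (ε * s)‖) := by ring
      _ ≤ B * ε * t ^ s.re * ((1 + |s.im|) ^ N * ‖Φ (ε * s)‖) := by gcongr
      _ ≤ B * ε * t ^ s.re * (D / ε ^ N) := by gcongr
      _ = _ := by ring
  have hshift := contour_shift (fun s => G s * Ψ s) c₁ c (D * B * ε * t ^ c / ε ^ N) hcc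
    (hG.mul (by
      apply Differentiable.differentiableOn
      rw [hΨ]
      exact Differentiable.mul (by fun_prop) (hΦd.comp (by fun_prop))))
    (fun s h1 h2 => (hb s h1 h2).trans (by gcongr))
  rw [step0, integral_integral_swap hfub, hK, Measure.integral_comp_mul_left
    (fun y : ℝ => (fun s => G s * Ψ s) (c + y * I)) (-2 * Real.pi), hshift, norm_smul]
  have habs : ‖|(-2 * Real.pi)⁻¹|‖ = (2 * Real.pi)⁻¹ := by
    rw [Real.norm_eq_abs, abs_abs, abs_inv, neg_mul, abs_neg, abs_of_pos (by positivity)]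
  rw [habs]
  have hfin : ‖∫ y : ℝ, G (c₁ + y * I) * Ψ (c₁ + y * I)‖ ≤ (D * B * ε * t ^ c₁ / ε ^ N) * Real.pi := by
    rw [← integral_univ_inv_one_add_sq, ← integral_const_mul]
    apply norm_integral_le_of_norm_le (integrable_inv_one_add_sq.const_mul _)
    refine Eventually.of_forall fun y => ?_
    simpa using hb (c₁ + y * I) (by simp) (by simpa using hcc)
  calc _ ≤ (2 * Real.pi)⁻¹ * ((D * B * ε * t ^ c₁ / ε ^ N) * Real.pi) := by gcongr
    _ = _ := by ring

lemma logpow_le (j : ℕ) (ρ : ℝ) (hρ : 0 < ρ) : ∃ C : ℝ, 0 < C ∧ ∀ x : ℝ, 1 ≤ x →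
    Real.log x ^ j ≤ C * x ^ ρ := by
  set η := ρ / (j + 1) with hη
  have hη0 : 0 < η := by positivity
  refine ⟨(η ^ j)⁻¹, by positivity, fun x hx => ?_⟩
  have h1 := Real.log_le_rpow_div (by linarith : 0 ≤ x) hη0
  calc Real.log x ^ j ≤ (x ^ η / η) ^ j := by
        gcongr; exact Real.log_nonneg hx
    _ = (η ^ j)⁻¹ * x ^ (η * j) := by
        rw [div_pow, ← Real.rpow_natCast (x ^ η), ← Real.rpow_mul (by linarith)]; ring
    _ ≤ _ := by
        gcongr
        rw [hη, div_mul_eq_mul_div, div_le_iff₀ (by positivity)]; nlinarith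

lemma logint_aux (w : ℂ) (hw : 0 < w.re) (j : ℕ) :
    IntegrableOn (fun x : ℝ => (x : ℂ) ^ (-w - 1) * (Real.log x : ℂ) ^ j) (Ioi 1) := by
  obtain ⟨C, hC, h⟩ := logpow_le j (w.re / 2) (by linarith)
  have hi : IntegrableOn (fun x : ℝ => C * x ^ (-w.re / 2 - 1)) (Ioi 1) :=
    (integrableOn_Ioi_rpow_of_lt (by linarith) one_pos).const_mul C
  refine Integrable.mono' hi ?_ ?_
  · apply ContinuousOn.aestronglyMeasurable _ measurableSet_Ioi
    apply ContinuousOn.mul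
    · intro x hx
      have hx0 : (0:ℝ) < x := lt_trans one_pos hx
      exact (Complex.continuousAt_ofReal_cpow_const x _ (Or.inr hx0.ne')).continuousWithinAt
    · apply ContinuousOn.pow
      apply Complex.continuous_ofReal.comp_continuousOn
      apply Real.continuousOn_log.mono
      intro x hx
      have hx0 : (0:ℝ) < x := lt_trans one_pos hx
      exact hx0.ne'
  · refine (ae_restrict_iff' measurableSet_Ioi).2 (Eventually.of_forall fun x hx => ?_)
    have hx1 : (1:ℝ) < x := hx
    have hx0 : (0:ℝ) < x := lt_trans one_pos hx
    rw [norm_mul, Complex.norm_cpow_eq_rpow_re_of_pos hx0, norm_pow, Complex.norm_real,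
      Real.norm_eq_abs, abs_of_nonneg (Real.log_nonneg hx1.le)]
    calc x ^ (-w - 1).re * Real.log x ^ j ≤ x ^ (-w - 1).re * (C * x ^ (w.re / 2)) := by
          gcongr; exact h x hx1.le
      _ = C * (x ^ (-w - 1).re * x ^ (w.re / 2)) := by ring
      _ = _ := by rw [← Real.rpow_add hx0]; congr 2; simp; ring

lemma logint_val (w : ℂ) (hw : 0 < w.re) (j : ℕ) :
    ∫ x in Ioi (1:ℝ), (x : ℂ) ^ (-w - 1) * (Real.log x : ℂ) ^ j = (j.factorial : ℂ) / w ^ (j + 1) := by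
  have hw0 : w ≠ 0 := by rintro rfl; simp at hw
  have hd : ∀ x : ℝ, 0 < x → HasDerivAt (fun y : ℝ => (y : ℂ) ^ (-w)) (-w * (x : ℂ) ^ (-w - 1)) x := by
    intro x hx
    exact hasDerivAt_ofReal_cpow_const hx.ne' (neg_ne_zero.2 hw0)
  have hl : ∀ x : ℝ, 0 < x → HasDerivAt (fun y : ℝ => (Real.log y : ℂ)) ((x⁻¹ : ℝ) : ℂ) x :=
    fun x hx => (Real.hasDerivAt_log hx.ne').ofReal_comp
  have htend : ∀ j : ℕ, Tendsto (fun x : ℝ => (x : ℂ) ^ (-w) * (Real.log x : ℂ) ^ j) atTop (nhds 0) := by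
    intro j
    obtain ⟨C, hC, h⟩ := logpow_le j (w.re / 2) (by linarith)
    have ht : Tendsto (fun x : ℝ => C * x ^ (-(w.re / 2))) atTop (nhds 0) := by
      simpa using (tendsto_rpow_neg_atTop (by linarith : 0 < w.re / 2)).const_mul C
    refine squeeze_zero_norm' ?_ ht
    filter_upwards [eventually_ge_atTop 1] with x hx1
    have hx0 : (0:ℝ) < x := by linarith
    rw [norm_mul, Complex.norm_cpow_eq_rpow_re_of_pos hx0, norm_pow, Complex.norm_real,
      Real.norm_eq_abs, abs_of_nonneg (Real.log_nonneg hx1)]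
    calc x ^ (-w).re * Real.log x ^ j ≤ x ^ (-w).re * (C * x ^ (w.re / 2)) := by
          gcongr; exact h x hx1
      _ = C * (x ^ (-w).re * x ^ (w.re / 2)) := by ring
      _ = _ := by rw [← Real.rpow_add hx0]; congr 2; simp; ring
  induction j with
  | zero =>
    have := integral_Ioi_of_hasDerivAt_of_tendsto (a := 1)
      (hd 1 one_pos).continuousAt.continuousWithinAt
      (fun x hx => hd x (lt_trans one_pos hx))
      (by simpa [IntegrableOn] using (logint_aux w hw 0).const_mul (-w)) (by simpa using htend 0)
    rw [integral_const_mul] at this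
    simp at this ⊢
    field_simp
    linear_combination this
  | succ j ih =>
    have hd2 : ∀ x : ℝ, 0 < x → HasDerivAt (fun y : ℝ => (y : ℂ) ^ (-w) * (Real.log y : ℂ) ^ (j + 1))
        (-w * ((x : ℂ) ^ (-w - 1) * (Real.log x : ℂ) ^ (j + 1)) +
          (j + 1 : ℂ) * ((x : ℂ) ^ (-w - 1) * (Real.log x : ℂ) ^ j)) x := by
      intro x hx
      refine ((hd x hx).mul ((hl x hx).pow (j + 1))).congr_deriv ?_
      have hxc : (x : ℂ) ≠ 0 := by exact_mod_cast hx.ne'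
      rw [Complex.cpow_sub _ _ hxc, Complex.cpow_one]
      push_cast
      simp
      field_simp
    have i1 := (logint_aux w hw (j+1)).const_mul (-w)
    have i2 := (logint_aux w hw j).const_mul (j + 1 : ℂ)
    have := integral_Ioi_of_hasDerivAt_of_tendsto (a := 1)
      (hd2 1 one_pos).continuousAt.continuousWithinAt
      (fun x hx => hd2 x (lt_trans one_pos hx)) (i1.add i2) (htend (j + 1))
    rw [integral_add i1 i2, integral_const_mul, integral_const_mul, ih] at this
    simp at this
    rw [Nat.factorial_succ]
    push_cast
    field_simp at this ⊢
    linear_combination -this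

lemma taylor_div (D : Set ℂ) (a : ℂ) (hD : D ∈ nhds a) (H : ℂ → ℂ) (hH : DifferentiableOn ℂ H D)
    (n : ℕ) : ∃ (h : ℕ → ℂ) (G : ℂ → ℂ), DifferentiableOn ℂ G D ∧
      ∀ s, H s = (∑ k ∈ Finset.range n, h k * (s - a) ^ k) + (s - a) ^ n * G s := by
  induction n with
  | zero => exact ⟨0, H, hH, fun s => by simp⟩
  | succ n ih =>
    obtain ⟨h, G, hG, e⟩ := ih
    refine ⟨fun k => if k = n then G a else h k, dslope G a,
      (Complex.differentiableOn_dslope hD).2 hG, fun s => ?_⟩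
    have h1 := sub_smul_dslope G a s
    rw [smul_eq_mul] at h1
    rw [Finset.sum_range_succ, e s]
    beta_reduce
    rw [if_pos rfl]
    have h2 : ∑ x ∈ Finset.range n, (if x = n then G a else h x) * (s - a) ^ x =
        ∑ k ∈ Finset.range n, h k * (s - a) ^ k := by
      apply Finset.sum_congr rfl
      intro k hk
      rw [if_neg (Finset.mem_range.1 hk).ne]
    rw [h2]
    linear_combination -(s - a) ^ n * h1

/-- the complex main term -/
noncomputable def mainR (a : ℝ) (b : ℕ) (h : ℕ → ℂ) : ℝ → ℂ := (Ioi (1:ℝ)).indicator fun x =>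
  ∑ k ∈ Finset.range b, (h k / ((b - 1 - k).factorial : ℂ)) *
    (((x ^ (a - 1) : ℝ) : ℂ) * (Real.log x : ℂ) ^ (b - 1 - k))

lemma exp_log_eq (x : ℝ) (hx : 0 < x) (s : ℂ) : cexp (-s * Real.log x) = (x : ℂ) ^ (-s) := by
  rw [Complex.cpow_def_of_ne_zero (by exact_mod_cast hx.ne'), Complex.ofReal_log hx.le, mul_comm]

lemma mainR_transform (a : ℝ) (b : ℕ) (h : ℕ → ℂ) (s : ℂ) (hs : a < s.re) :
    IntegrableOn (fun x : ℝ => cexp (-s * Real.log x) * mainR a b h x) (Ioi 0) ∧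
    ∫ x in Ioi (0:ℝ), cexp (-s * Real.log x) * mainR a b h x =
      ∑ k ∈ Finset.range b, h k * (s - a) ^ k / (s - a) ^ b := by
  have hw : 0 < (s - a).re := by simpa using hs
  have hw0 : s - a ≠ 0 := by intro h; rw [h] at hw; simp at hw
  have e : (fun x : ℝ => cexp (-s * Real.log x) * mainR a b h x) = (Ioi (1:ℝ)).indicator fun x =>
      ∑ k ∈ Finset.range b, (h k / ((b - 1 - k).factorial : ℂ)) *
        ((x : ℂ) ^ (-(s - a) - 1) * (Real.log x : ℂ) ^ (b - 1 - k)) := by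
    ext x
    unfold mainR
    by_cases hx : x ∈ Ioi (1:ℝ)
    · rw [indicator_of_mem hx, indicator_of_mem hx, Finset.mul_sum]
      have hx0 : (0:ℝ) < x := lt_trans one_pos hx
      apply Finset.sum_congr rfl
      intro k _
      have : (x : ℂ) ^ (-(s - a) - 1) = cexp (-s * Real.log x) * ((x ^ (a - 1) : ℝ) : ℂ) := by
        rw [exp_log_eq x hx0, Complex.ofReal_cpow hx0.le, ← Complex.cpow_add _ _ (by exact_mod_cast hx0.ne')]
        congr 1; push_cast; ring
      rw [this]; ring
    · rw [indicator_of_notMem hx, indicator_of_notMem hx, mul_zero]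
  have hsub : Ioi (1:ℝ) ⊆ Ioi 0 := Ioi_subset_Ioi zero_le_one
  have hi : ∀ k ∈ Finset.range b, IntegrableOn (fun x : ℝ => (h k / ((b - 1 - k).factorial : ℂ)) *
        ((x : ℂ) ^ (-(s - a) - 1) * (Real.log x : ℂ) ^ (b - 1 - k))) (Ioi 1) := fun k _ =>
    (logint_aux (s - a) hw _).const_mul _
  rw [e]
  constructor
  · rw [IntegrableOn, integrable_indicator_iff measurableSet_Ioi, IntegrableOn,
      Measure.restrict_restrict measurableSet_Ioi, inter_eq_left.2 hsub]
    exact integrable_finsetSum _ hi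
  · rw [setIntegral_indicator measurableSet_Ioi, inter_eq_right.2 hsub, integral_finsetSum _ hi]
    apply Finset.sum_congr rfl
    intro k hk
    have hk' := Finset.mem_range.1 hk
    rw [integral_const_mul, logint_val _ hw]
    have hb : (s - a) ^ b = (s - a) ^ k * (s - a) ^ (b - 1 - k + 1) := by
      rw [← pow_add]; congr 1; omega
    rw [hb]
    have : ((b - 1 - k).factorial : ℂ) ≠ 0 := by exact_mod_cast Nat.factorial_ne_zero _
    field_simp

/-- the real polynomial -/
noncomputable def mainP (b : ℕ) (h : ℕ → ℂ) : Polynomial ℝ :=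
  ∑ k ∈ Finset.range b, Polynomial.C ((h k / ((b - 1 - k).factorial : ℂ)).re) *
    Polynomial.X ^ (b - 1 - k)

lemma mainR_re (a : ℝ) (b : ℕ) (h : ℕ → ℂ) (x : ℝ) (hx : 1 < x) :
    (mainR a b h x).re = x ^ (a - 1) * (mainP b h).eval (Real.log x) := by
  unfold mainR mainP
  rw [indicator_of_mem (show x ∈ Ioi 1 from hx), Complex.re_sum, Polynomial.eval_finsetSum,
    Finset.mul_sum]
  apply Finset.sum_congr rfl
  intro k _
  rw [← Complex.ofReal_pow, ← Complex.ofReal_mul, Complex.re_mul_ofReal]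
  simp only [Polynomial.eval_mul, Polynomial.eval_C, Polynomial.eval_pow, Polynomial.eval_X]
  ring

lemma poly_le_exp (Q : Polynomial ℝ) (ρ : ℝ) (hρ : 0 < ρ) :
    ∃ C : ℝ, 0 < C ∧ ∀ u : ℝ, 0 ≤ u → |Q.eval u| ≤ C * Real.exp (ρ * u) := by
  induction Q using Polynomial.induction_on' with
  | add p q hp hq =>
    obtain ⟨C1, h1, H1⟩ := hp
    obtain ⟨C2, h2, H2⟩ := hq
    refine ⟨C1 + C2, by positivity, fun u hu => ?_⟩
    rw [Polynomial.eval_add, add_mul]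
    exact (abs_add_le _ _).trans (add_le_add (H1 u hu) (H2 u hu))
  | monomial n r =>
    obtain ⟨C, hC, H⟩ := logpow_le n ρ hρ
    refine ⟨(|r| + 1) * C, by positivity, fun u hu => ?_⟩
    have := H (Real.exp u) (Real.one_le_exp hu)
    rw [Real.log_exp, ← Real.exp_mul, mul_comm u] at this
    rw [Polynomial.eval_monomial, abs_mul, abs_of_nonneg (pow_nonneg hu n), mul_assoc]
    have h0 := pow_nonneg hu n
    nlinarith [abs_nonneg r]

lemma main_lip (a : ℝ) (P : Polynomial ℝ) (ρ : ℝ) (hρ : 0 < ρ) :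
    ∃ C : ℝ, 0 < C ∧ ∀ t x ε : ℝ, 0 < ε → ε ≤ 1 → Real.exp 2 ≤ t → 0 < x →
      |Real.log x - Real.log t| ≤ 2 * ε →
      |x ^ (a - 1) * P.eval (Real.log x) - t ^ (a - 1) * P.eval (Real.log t)|
        ≤ C * ε * t ^ (a - 1 + ρ) := by
  obtain ⟨C, hC, H⟩ := poly_le_exp (Polynomial.C (a - 1) * P + P.derivative) ρ hρ
  refine ⟨C * Real.exp (2 * |a - 1 + ρ|) * 2, by positivity, fun t x ε hε hε1 ht hx hxt => ?_⟩
  have ht0 : 0 < t := (Real.exp_pos 2).trans_le ht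
  have hU : 2 ≤ Real.log t := (Real.le_log_iff_exp_le ht0).2 ht
  rw [Real.rpow_def_of_pos hx, Real.rpow_def_of_pos ht0, Real.rpow_def_of_pos ht0]
  set u := Real.log x
  set U := Real.log t
  have hd : ∀ y : ℝ, HasDerivAt (fun y => Real.exp (y * (a - 1)) * P.eval y)
      (Real.exp (y * (a - 1)) * (Polynomial.C (a - 1) * P + P.derivative).eval y) y := by
    intro y
    refine ((((hasDerivAt_id y).mul_const (a - 1)).exp).mul (P.hasDerivAt y)).congr_deriv ?_
    simp
    ring
  have := (convex_Icc (U - 2 * ε) (U + 2 * ε)).norm_image_sub_le_of_norm_hasDerivWithin_le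
    (C := C * Real.exp (2 * |a - 1 + ρ|) * Real.exp (U * (a - 1 + ρ)))
    (fun y _ => (hd y).hasDerivWithinAt) (fun y hy => ?_) (x := U) (y := u)
    ⟨by linarith, by linarith⟩ ⟨by linarith [(abs_le.1 hxt).1], by linarith [(abs_le.1 hxt).2]⟩
  · rw [Real.norm_eq_abs, Real.norm_eq_abs] at this
    refine this.trans ?_
    calc _ ≤ C * Real.exp (2 * |a - 1 + ρ|) * Real.exp (U * (a - 1 + ρ)) * (2 * ε) := by gcongr
      _ = _ := by ring
  · rw [norm_mul, Real.norm_eq_abs, Real.norm_eq_abs, abs_of_pos (Real.exp_pos _)]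
    calc _ ≤ Real.exp (y * (a - 1)) * (C * Real.exp (ρ * y)) := by
          gcongr; exact H y (by linarith [hy.1])
      _ = C * Real.exp (y * (a - 1 + ρ)) := by
          rw [mul_left_comm, ← Real.exp_add]; congr 2; ring
      _ ≤ C * Real.exp (2 * |a - 1 + ρ| + U * (a - 1 + ρ)) := by
          gcongr
          have h1 : |y - U| ≤ 2 := abs_le.2 ⟨by linarith [hy.1], by linarith [hy.2]⟩
          have h2 : (y - U) * (a - 1 + ρ) ≤ |y - U| * |a - 1 + ρ| :=
            (le_abs_self _).trans (abs_mul _ _).le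
          nlinarith [abs_nonneg (a - 1 + ρ)]
      _ = _ := by rw [Real.exp_add]; ring

lemma avg_bound (φ : ℝ → ℝ) (h0 : ∀ y, 0 ≤ φ y) (h1 : ∀ y, |y| ≤ 1/2 → φ y = 1)
    (h2 : ∀ y, 1 ≤ |y| → φ y = 0) (W : ℝ → ℝ) (τ ε K E : ℝ) (hτ : 0 < τ) (hε : 0 < ε)
    (hint : IntegrableOn (fun x => W x * φ ((Real.log τ - Real.log x) / ε)) (Ioi 0))
    (hK : ∀ x, 0 < x → |Real.log τ - Real.log x| < ε → K ≤ W x)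
    (hE : |∫ x in Ioi (0:ℝ), W x * φ ((Real.log τ - Real.log x) / ε)| ≤ E) :
    K ≤ E / (τ * ε / 2) := by
  have hE0 : 0 ≤ E := (abs_nonneg _).trans hE
  rcases le_or_gt K 0 with hK0 | hK0
  · exact hK0.trans (by positivity)
  rw [le_div_iff₀ (by positivity)]
  have hsub : Icc τ (τ * Real.exp (ε / 2)) ⊆ Ioi 0 := fun x hx => lt_of_lt_of_le hτ hx.1
  have hlen : ∫ x in Ioi (0:ℝ), (Icc τ (τ * Real.exp (ε / 2))).indicator (fun _ => K) x
      = (τ * Real.exp (ε / 2) - τ) * K := by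
    rw [setIntegral_indicator measurableSet_Icc, inter_eq_right.2 hsub, setIntegral_const,
      Real.volume_real_Icc_of_le (by
        have := Real.one_le_exp (by positivity : 0 ≤ ε / 2)
        nlinarith), smul_eq_mul]
  have hle : ∫ x in Ioi (0:ℝ), (Icc τ (τ * Real.exp (ε / 2))).indicator (fun _ => K) x ≤
      ∫ x in Ioi (0:ℝ), W x * φ ((Real.log τ - Real.log x) / ε) := by
    apply integral_mono_of_nonneg
    · exact Eventually.of_forall fun x => indicator_nonneg (fun _ _ => hK0.le) x
    · exact hint
    · refine (ae_restrict_iff' measurableSet_Ioi).2 (Eventually.of_forall fun x hx => ?_)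
      have hx0 : 0 < x := hx
      beta_reduce
      by_cases hc : |Real.log τ - Real.log x| < ε
      · have hKx := hK x hx hc
        by_cases hxm : x ∈ Icc τ (τ * Real.exp (ε / 2))
        · have e1 : Real.log τ ≤ Real.log x := Real.log_le_log hτ hxm.1
          have e2 : Real.log x ≤ Real.log τ + ε / 2 := by
            have := Real.log_le_log hx0 hxm.2
            rwa [Real.log_mul hτ.ne' (Real.exp_ne_zero _), Real.log_exp] at this
          rw [indicator_of_mem hxm, h1, mul_one]
          · exact hKx
          · rw [abs_div, abs_of_pos hε, div_le_iff₀ hε, abs_le]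
            constructor <;> linarith
        · rw [indicator_of_notMem hxm]
          exact mul_nonneg (hK0.le.trans hKx) (h0 _)
      · have hz : φ ((Real.log τ - Real.log x) / ε) = 0 := by
          apply h2
          rw [abs_div, abs_of_pos hε, le_div_iff₀ hε]; linarith
        rw [hz, mul_zero, indicator_of_notMem]
        intro hxm
        apply hc
        have e1 : Real.log τ ≤ Real.log x := Real.log_le_log hτ hxm.1
        have e2 : Real.log x ≤ Real.log τ + ε / 2 := by
          have := Real.log_le_log hx0 hxm.2
          rwa [Real.log_mul hτ.ne' (Real.exp_ne_zero _), Real.log_exp] at this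
        rw [abs_lt]; constructor <;> linarith
  rw [hlen] at hle
  have h5 := Real.add_one_le_exp (ε / 2)
  have h6 := (le_abs_self _).trans hE
  have h7 : τ * ε / 2 ≤ τ * Real.exp (ε / 2) - τ := by nlinarith
  nlinarith

lemma rpow_comp (p t τ : ℝ) (ht : 0 < t) (hτ : 0 < τ) (h : |Real.log τ - Real.log t| ≤ 1) :
    τ ^ p ≤ Real.exp |p| * t ^ p := by
  rw [Real.rpow_def_of_pos hτ, Real.rpow_def_of_pos ht, ← Real.exp_add]
  apply Real.exp_le_exp.2
  have h2 : (Real.log τ - Real.log t) * p ≤ |Real.log τ - Real.log t| * |p| :=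
    (le_abs_self _).trans (abs_mul _ _).le
  nlinarith [abs_nonneg p]

lemma desmooth (φ : ℝ → ℝ) (h0 : ∀ y, 0 ≤ φ y) (h1 : ∀ y, |y| ≤ 1/2 → φ y = 1)
    (h2 : ∀ y, 1 ≤ |y| → φ y = 0) (v : ℝ → ℝ) (T : ℝ)
    (hv_mono : ∀ x y : ℝ, T ≤ x → x ≤ y → v x ≤ v y) (P : Polynomial ℝ) (a : ℝ) (V : ℝ → ℂ)
    (hV : ∀ x, 1 < x → (V x).re = v x - x ^ (a - 1) * P.eval (Real.log x))
    (δ₁ : ℝ) (hδ₁ : 0 < δ₁) (C₀ : ℝ) (hC₀ : 0 ≤ C₀) (N : ℕ)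
    (hsm : ∀ t ε : ℝ, 1 ≤ t → 0 < ε → ε ≤ 1 →
      IntegrableOn (fun x : ℝ => V x * (φ ((Real.log t - Real.log x) / ε) : ℂ)) (Ioi 0) ∧
      ‖∫ x in Ioi (0:ℝ), V x * (φ ((Real.log t - Real.log x) / ε) : ℂ)‖
        ≤ C₀ * ε * t ^ (a - δ₁) / ε ^ N) :
    ∃ δ > (0:ℝ), ∃ C > (0:ℝ), ∃ T : ℝ, ∀ t ≥ T,
      |v t - t ^ (a - 1) * P.eval (Real.log t)| ≤ C * t ^ (a - 1 - δ) := by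
  set η := δ₁ / (2 * (N + 1)) with hη
  have hη0 : 0 < η := by positivity
  have hηN : η * N + η = δ₁ / 2 := by rw [hη]; field_simp
  obtain ⟨Cl, hCl, hlip⟩ := main_lip a P (η / 2) (by positivity)
  refine ⟨η / 2, by positivity, Cl + 2 * C₀ * Real.exp |a - 1 - δ₁|, by positivity,
    Real.exp 2 * max 2 T, fun t ht => ?_⟩
  have he2 : (1:ℝ) ≤ Real.exp 2 := Real.one_le_exp (by norm_num)
  have hm2 : (2:ℝ) ≤ max 2 T := le_max_left _ _
  have ht2 : Real.exp 2 ≤ t := by nlinarith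
  have ht1 : 1 ≤ t := he2.trans ht2
  have ht0 : 0 < t := by linarith
  have hlogt : 2 ≤ Real.log t := (Real.le_log_iff_exp_le ht0).2 ht2
  have hback : ∀ x, 0 < x → Real.log t - 2 ≤ Real.log x → max 2 T ≤ x := by
    intro x hx hl
    have : Real.log (t / Real.exp 2) ≤ Real.log x := by
      rwa [Real.log_div ht0.ne' (Real.exp_ne_zero _), Real.log_exp]
    have h3 := (Real.log_le_log_iff (by positivity) hx).1 this
    refine le_trans ?_ h3
    rw [le_div_iff₀ (by positivity)]; linarith
  set ε := t ^ (-η) with hε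
  have hε0 : 0 < ε := by positivity
  have hε1 : ε ≤ 1 := Real.rpow_le_one_of_one_le_of_nonpos ht1 (by linarith)
  have key : ∀ τ, 0 < τ → |Real.log τ - Real.log t| ≤ 1 → ∀ θ : ℝ, |θ| = 1 → ∀ K : ℝ,
      (∀ x, 0 < x → |Real.log τ - Real.log x| < ε → K ≤ θ * (V x).re) →
      K ≤ 2 * C₀ * Real.exp |a - 1 - δ₁| * t ^ (a - 1 - η / 2) := by
    intro τ hτ hτt θ hθ K hK
    have hτ1 : 1 ≤ τ := by
      have := hback τ hτ (by linarith [(abs_le.1 hτt).1]); linarith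
    obtain ⟨i1, i2⟩ := hsm τ ε hτ1 hε0 hε1
    have hre : ∀ x, θ * (V x).re * φ ((Real.log τ - Real.log x) / ε) =
        θ * (V x * (φ ((Real.log τ - Real.log x) / ε) : ℂ)).re := by
      intro x; rw [Complex.re_mul_ofReal]; ring
    have hA := avg_bound φ h0 h1 h2 (fun x => θ * (V x).re) τ ε K (C₀ * ε * τ ^ (a - δ₁) / ε ^ N)
      hτ hε0 (by
        simp_rw [hre]
        exact (Integrable.re i1).const_mul θ) hK (by
        simp_rw [hre]
        rw [integral_const_mul, abs_mul, hθ, one_mul]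
        have := Complex.reCLM.integral_comp_comm i1
        simp only [Complex.reCLM_apply] at this
        rw [this]
        exact (Complex.abs_re_le_norm _).trans i2)
    refine hA.trans ?_
    have e1 : C₀ * ε * τ ^ (a - δ₁) / ε ^ N / (τ * ε / 2) = 2 * C₀ * τ ^ (a - 1 - δ₁) * t ^ (η * N) := by
      have e2 : τ ^ (a - δ₁) = τ ^ (a - 1 - δ₁) * τ := by
        rw [← Real.rpow_add_one hτ.ne']; congr 1; ring
      have e3 : ε ^ N * t ^ (η * N) = 1 := by
        rw [hε, ← Real.rpow_natCast, ← Real.rpow_mul ht0.le, ← Real.rpow_add ht0]; simp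
      rw [e2, div_div, div_eq_iff (by positivity)]
      linear_combination (-C₀ * ε * τ * τ ^ (a - 1 - δ₁)) * e3
    rw [e1]
    calc 2 * C₀ * τ ^ (a - 1 - δ₁) * t ^ (η * N)
        ≤ 2 * C₀ * (Real.exp |a - 1 - δ₁| * t ^ (a - 1 - δ₁)) * t ^ (η * N) := by
          gcongr; exact rpow_comp _ t τ ht0 hτ hτt
      _ = 2 * C₀ * Real.exp |a - 1 - δ₁| * t ^ (a - 1 - δ₁ + η * N) := by
          rw [Real.rpow_add ht0]; ring
      _ ≤ _ := by
          gcongr; linarith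
  have hω : Cl * ε * t ^ (a - 1 + η / 2) = Cl * t ^ (a - 1 - η / 2) := by
    rw [hε, mul_assoc, ← Real.rpow_add ht0]; congr 2; ring
  rw [add_mul, abs_le]
  constructor
  · have := key (t * Real.exp (-ε)) (by positivity)
      (by rw [Real.log_mul ht0.ne' (Real.exp_ne_zero _), Real.log_exp, add_sub_cancel_left, abs_neg,
        abs_of_pos hε0]; exact hε1) (-1) (by simp)
      (t ^ (a - 1) * P.eval (Real.log t) - v t - Cl * t ^ (a - 1 - η / 2)) (by
        intro x hx hxτ
        rw [Real.log_mul ht0.ne' (Real.exp_ne_zero _), Real.log_exp, abs_lt] at hxτ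
        have hxb := hback x hx (by linarith [hxτ.2])
        have hx2 : 2 ≤ x := hm2.trans hxb
        have hxt : x ≤ t := (Real.log_le_log_iff hx ht0).1 (by linarith [hxτ.1])
        have hL := hlip t x ε hε0 hε1 ht2 hx (abs_le.2 ⟨by linarith [hxτ.2], by linarith [hxτ.1]⟩)
        rw [hω] at hL
        rw [hV x (by linarith)]
        have hvm := hv_mono x t ((le_max_right _ _).trans hxb) hxt
        linarith [(abs_le.1 hL).1, (abs_le.1 hL).2])
    linarith
  · have := key (t * Real.exp ε) (by positivity)
      (by rw [Real.log_mul ht0.ne' (Real.exp_ne_zero _), Real.log_exp, add_sub_cancel_left,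
        abs_of_pos hε0]; exact hε1) 1 (by simp)
      (v t - t ^ (a - 1) * P.eval (Real.log t) - Cl * t ^ (a - 1 - η / 2)) (by
        intro x hx hxτ
        rw [Real.log_mul ht0.ne' (Real.exp_ne_zero _), Real.log_exp, abs_lt] at hxτ
        have hxt : t ≤ x := (Real.log_le_log_iff ht0 hx).1 (by linarith [hxτ.2])
        have hL := hlip t x ε hε0 hε1 ht2 hx (abs_le.2 ⟨by linarith [hxτ.2], by linarith [hxτ.1]⟩)
        rw [hω] at hL
        rw [hV x (by linarith [Real.add_one_le_exp (2:ℝ)])]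
        have hvm := hv_mono t x ((le_max_right _ _).trans (hback t ht0 (by linarith))) hxt
        linarith [(abs_le.1 hL).1, (abs_le.1 hL).2])
    linarith

lemma G_bound (F G : ℂ → ℂ) (a : ℝ) (b : ℕ) (δ₀ κ Cκ c₁ c : ℝ) (hκ : 0 < κ) (hCκ : 0 < Cκ)
    (hc₁ : a - δ₀ < c₁) (h : ℕ → ℂ)
    (hG : DifferentiableOn ℂ G {s : ℂ | a - δ₀ < s.re})
    (hFG : ∀ s : ℂ, a - δ₀ < s.re → s ≠ (a : ℂ) →
      F s = (∑ k ∈ Finset.range b, h k * (s - a) ^ k / (s - a) ^ b) + G s)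
    (hbound : ∀ s : ℂ, a - δ₀ < s.re → s ≠ (a : ℂ) →
      ‖F s * (s - (a : ℂ)) ^ b / s ^ b‖ ≤ Cκ * (1 + |s.im|) ^ κ) :
    ∃ B : ℝ, 0 ≤ B ∧ ∀ s : ℂ, c₁ ≤ s.re → s.re ≤ c → ‖G s‖ ≤ B * (1 + |s.im|) ^ κ := by
  have hcomp : IsCompact (Icc c₁ c ×ℂ Icc (-1:ℝ) 1) := isCompact_Icc.reProdIm isCompact_Icc
  obtain ⟨B₁, hB₁⟩ := hcomp.exists_bound_of_continuousOn (f := G) (hG.continuousOn.mono (by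
    intro s hs
    rw [Complex.mem_reProdIm] at hs
    exact lt_of_lt_of_le hc₁ hs.1.1))
  set S := ∑ k ∈ Finset.range b, ‖h k‖ with hS
  have hS0 : 0 ≤ S := Finset.sum_nonneg fun k _ => norm_nonneg _
  refine ⟨max B₁ 0 + (Cκ * (1 + |a|) ^ b + S), by positivity, fun s h1 h2 => ?_⟩
  have hone : 1 ≤ (1 + |s.im|) ^ κ := Real.one_le_rpow (by linarith [abs_nonneg s.im]) hκ.le
  rw [add_mul]
  rcases le_or_gt |s.im| 1 with him | him
  · have := hB₁ s (by rw [Complex.mem_reProdIm]; exact ⟨⟨h1, h2⟩, abs_le.1 him⟩)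
    have h3 : B₁ ≤ max B₁ 0 := le_max_left _ _
    have h4 : 0 ≤ max B₁ 0 := le_max_right _ _
    have h5 : 0 ≤ (Cκ * (1 + |a|) ^ b + S) * (1 + |s.im|) ^ κ := by positivity
    nlinarith
  · have hne : s ≠ a := by rintro rfl; simp at him; linarith
    have hs0 : s ≠ 0 := by rintro rfl; simp at him; linarith
    have hsa : 1 ≤ ‖s - a‖ := by
      have := Complex.abs_im_le_norm (s - a)
      simp at this; linarith
    have hsa0 : s - a ≠ 0 := sub_ne_zero.2 hne
    have hle : ‖s‖ ≤ (1 + |a|) * ‖s - a‖ := by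
      have : ‖s‖ ≤ ‖s - a‖ + ‖(a : ℂ)‖ := by simpa using norm_add_le (s - a) (a : ℂ)
      rw [Complex.norm_real, Real.norm_eq_abs] at this
      nlinarith [abs_nonneg a]
    have hbd := hbound s (lt_of_lt_of_le hc₁ h1) hne
    have hF : ‖F s‖ ≤ Cκ * (1 + |a|) ^ b * (1 + |s.im|) ^ κ := by
      have e : F s = (F s * (s - a) ^ b / s ^ b) * (s ^ b / (s - a) ^ b) := by
        field_simp
      rw [e, norm_mul]
      have : ‖s ^ b / (s - a) ^ b‖ ≤ (1 + |a|) ^ b := by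
        rw [norm_div, norm_pow, norm_pow, div_le_iff₀ (by positivity), ← mul_pow]
        gcongr
      calc _ ≤ Cκ * (1 + |s.im|) ^ κ * (1 + |a|) ^ b := by gcongr
        _ = _ := by ring
    have hPP : ‖∑ k ∈ Finset.range b, h k * (s - a) ^ k / (s - a) ^ b‖ ≤ S := by
      refine (norm_sum_le _ _).trans (Finset.sum_le_sum fun k hk => ?_)
      rw [norm_div, norm_mul, norm_pow, norm_pow, div_le_iff₀ (by positivity)]
      gcongr; exact (Finset.mem_range.1 hk).le
    have e : G s = F s - ∑ k ∈ Finset.range b, h k * (s - a) ^ k / (s - a) ^ b := by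
      rw [hFG s (lt_of_lt_of_le hc₁ h1) hne]; ring
    rw [e]
    have h4 : 0 ≤ max B₁ 0 := le_max_right _ _
    have := norm_sub_le (F s) (∑ k ∈ Finset.range b, h k * (s - a) ^ k / (s - a) ^ b)
    nlinarith


lemma H_diffOn (F H : ℂ → ℂ) (a : ℝ) (b : ℕ) (δ₀ : ℝ)
    (hF_hol : DifferentiableOn ℂ F {s : ℂ | a - δ₀ < s.re ∧ s ≠ (a : ℂ)})
    (hHa : AnalyticAt ℂ H (a : ℂ))
    (hH : ∀ s : ℂ, a - δ₀ < s.re → s ≠ (a : ℂ) → H s = (s - (a : ℂ)) ^ b * F s) :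
    DifferentiableOn ℂ H {s : ℂ | a - δ₀ < s.re} := by
  intro s hs
  by_cases hsa : s = a
  · subst hsa; exact hHa.differentiableAt.differentiableWithinAt
  · have ho : IsOpen {s : ℂ | a - δ₀ < s.re ∧ s ≠ (a : ℂ)} :=
      (isOpen_lt continuous_const Complex.continuous_re).inter isOpen_ne
    have hm : {s : ℂ | a - δ₀ < s.re ∧ s ≠ (a : ℂ)} ∈ nhds s := ho.mem_nhds ⟨hs, hsa⟩
    have hF := hF_hol.differentiableAt hm
    have : DifferentiableAt ℂ (fun s => (s - (a : ℂ)) ^ b * F s) s := by fun_prop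
    refine (this.congr_of_eventuallyEq ?_).differentiableWithinAt
    filter_upwards [hm] with z hz using hH z hz.1 hz.2

lemma no_small (v : ℝ → ℝ) (hv_meas : Measurable v) (hv_nonneg : ∀ x : ℝ, 0 ≤ x → 0 ≤ v x)
    (σ₀ : ℝ)
    (hconv : ∀ s : ℂ, σ₀ < s.re →
      IntegrableOn (fun x : ℝ => (x : ℂ) ^ (-s) * (v x : ℂ)) (Ioi 0))
    (F H : ℂ → ℂ) (a : ℝ) (b : ℕ) (hb : 0 < b) (δ₀ : ℝ) (hδ₀ : 0 < δ₀)
    (hFeq : ∀ s : ℂ, σ₀ < s.re →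
      F s = ∫ x in Ioi (0:ℝ), (x : ℂ) ^ (-s) * (v x : ℂ))
    (hHd : DifferentiableOn ℂ H {s : ℂ | a - δ₀ < s.re})
    (hH : ∀ s : ℂ, a - δ₀ < s.re → s ≠ (a : ℂ) → H s = (s - (a : ℂ)) ^ b * F s)
    (δ C T : ℝ) (hδ : 0 < δ) (hT : ∀ t ≥ T, |v t| ≤ C * t ^ (a - 1 - δ)) : H a = 0 := by
  set T' := max T 1 with hT'
  have hT1 : 1 ≤ T' := le_max_right _ _
  have hT0 : 0 < T' := by linarith
  have hint : ∀ σ ∈ Ioi (a - δ), Integrable (fun x => v x * Real.exp (σ * (-Real.log x)))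
      (volume.restrict (Ioi 0)) := by
    intro σ hσ
    have hmeas : Measurable (fun x => v x * Real.exp (σ * (-Real.log x))) := by fun_prop
    change IntegrableOn (fun x => v x * Real.exp (σ * (-Real.log x))) (Ioi (0:ℝ))
    rw [← Ioc_union_Ioi_eq_Ioi hT0.le]
    refine IntegrableOn.union ?_ ?_
    · set σ' := max σ₀ σ + 1 with hσ'
      have h1 := (hconv σ' (by simp [hσ']; linarith [le_max_left σ₀ σ])).norm
      have h2 := (IntegrableOn.mono_set h1 (Ioc_subset_Ioi_self : Ioc 0 T' ⊆ Ioi 0)).const_mul (T' ^ (σ' - σ))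
      refine Integrable.mono' h2 hmeas.aestronglyMeasurable ?_
      refine (ae_restrict_iff' measurableSet_Ioc).2 (ae_of_all _ fun x hx => ?_)
      have hx0 : 0 < x := hx.1
      have e : (x : ℂ) ^ (-(σ' : ℂ)) = ((x ^ (-σ') : ℝ) : ℂ) := by
        rw [Complex.ofReal_cpow hx0.le]; simp
      have e2 : Real.exp (σ * (-Real.log x)) = x ^ (-σ) := by
        rw [Real.rpow_def_of_pos hx0]; ring_nf
      rw [e, e2, norm_mul, norm_mul, Complex.norm_real, Complex.norm_real,
        Real.norm_of_nonneg (Real.rpow_nonneg hx0.le _),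
        Real.norm_of_nonneg (Real.rpow_nonneg hx0.le _)]
      have e3 : x ^ (-σ) = x ^ (σ' - σ) * x ^ (-σ') := by
        rw [← Real.rpow_add hx0]; ring_nf
      have e4 : x ^ (σ' - σ) ≤ T' ^ (σ' - σ) :=
        Real.rpow_le_rpow hx0.le hx.2 (by rw [hσ']; linarith [le_max_right σ₀ σ])
      rw [e3]
      have : 0 ≤ x ^ (-σ') * ‖v x‖ := by positivity
      calc _ = x ^ (σ' - σ) * (x ^ (-σ') * ‖v x‖) := by ring
        _ ≤ _ := mul_le_mul_of_nonneg_right e4 this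
    · have h2 := (integrableOn_Ioi_rpow_of_lt (a := a - 1 - δ - σ)
        (by have : a - δ < σ := hσ
            linarith) hT0).const_mul C
      refine Integrable.mono' h2 hmeas.aestronglyMeasurable ?_
      refine (ae_restrict_iff' measurableSet_Ioi).2 (ae_of_all _ fun x hx => ?_)
      have hx0 : 0 < x := hT0.trans hx
      have e2 : Real.exp (σ * (-Real.log x)) = x ^ (-σ) := by
        rw [Real.rpow_def_of_pos hx0]; ring_nf
      rw [e2, norm_mul, Real.norm_of_nonneg (Real.rpow_nonneg hx0.le _)]
      have e3 : x ^ (a - 1 - δ - σ) = x ^ (a - 1 - δ) * x ^ (-σ) := by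
        rw [← Real.rpow_add hx0]; ring_nf
      rw [e3, ← mul_assoc]
      exact mul_le_mul_of_nonneg_right (hT x ((le_max_left _ _).trans (le_of_lt hx)))
        (Real.rpow_nonneg hx0.le _)
  have hhol := holo_exp (volume.restrict (Ioi 0)) (fun x => -Real.log x) v hv_meas
    ((ae_restrict_iff' measurableSet_Ioi).2 (ae_of_all _ fun x hx => hv_nonneg x (le_of_lt hx)))
    (Ioi (a - δ)) isOpen_Ioi hint
  set f : ℂ → ℂ := fun z => ∫ x in Ioi (0:ℝ), (v x : ℂ) * cexp (z * ((-Real.log x : ℝ) : ℂ)) with hf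
  have hδ' : 0 < min δ δ₀ := lt_min hδ hδ₀
  set U : Set ℂ := {s : ℂ | a - min δ δ₀ < s.re} with hU
  have hUo : IsOpen U := isOpen_lt continuous_const Complex.continuous_re
  have hUc : IsPreconnected U := (convex_halfSpace_re_gt _).isPreconnected
  have hA1 : AnalyticOnNhd ℂ H U := (hHd.mono (fun s hs => by
    have : a - min δ δ₀ < s.re := hs
    have := min_le_right δ δ₀
    show a - δ₀ < s.re
    linarith)).analyticOnNhd hUo
  have hfd : DifferentiableOn ℂ f U := hhol.mono (fun s hs => by
    have : a - min δ δ₀ < s.re := hs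
    have := min_le_left δ δ₀
    show a - δ < s.re
    linarith)
  have hA2 : AnalyticOnNhd ℂ (fun s => (s - (a:ℂ)) ^ b * f s) U :=
    DifferentiableOn.analyticOnNhd (by fun_prop) hUo
  set z₀ : ℂ := ((max σ₀ a + 1 : ℝ) : ℂ) with hz₀
  have hz₀m : z₀ ∈ U := by
    show a - min δ δ₀ < z₀.re
    rw [hz₀, Complex.ofReal_re]; linarith [le_max_right σ₀ a]
  have hev : H =ᶠ[nhds z₀] (fun s => (s - (a:ℂ)) ^ b * f s) := by
    have ho : IsOpen {s : ℂ | max σ₀ a < s.re} := isOpen_lt continuous_const Complex.continuous_re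
    have hm : z₀ ∈ {s : ℂ | max σ₀ a < s.re} := by
      show _ < z₀.re
      rw [hz₀, Complex.ofReal_re]; linarith
    filter_upwards [ho.mem_nhds hm] with s hs
    have hs1 : σ₀ < s.re := (le_max_left _ _).trans_lt hs
    have hs2 : a < s.re := (le_max_right _ _).trans_lt hs
    rw [hH s (by linarith) (by rintro rfl; simp at hs2), hFeq s hs1, hf]
    congr 1
    refine setIntegral_congr_fun measurableSet_Ioi fun x hx => ?_
    show _ = (v x : ℂ) * cexp (s * ((-Real.log x : ℝ) : ℂ))
    rw [← exp_log_eq x hx, mul_comm]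
    congr 2
    push_cast; ring
  have := hA1.eqOn_of_preconnected_of_eventuallyEq hA2 hUc hz₀m hev
    (show (a:ℂ) ∈ U by show a - min δ δ₀ < (a:ℂ).re; rw [Complex.ofReal_re]; linarith)
  rw [this]
  simp [hb.ne']

/-- **Tauberian theorem at infinity** (Gorodnik–Nevo, Proposition 8.10(1); after
Chambert-Loir–Tschinkel). Let `v : [0,∞) → [0,∞)` be measurable and eventually
increasing, and let `f(s) = ∫₀^∞ x^{−s} v(x) dx` converge absolutely for `Re s > σ₀`.
Suppose `f` extends meromorphically to `{Re s > a − δ₀}` with unique pole `s = a` of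
multiplicity `b` there, satisfying `|f(s) (s−a)^b / s^b| = O((1+|Im s|)^κ)`. Then
`v(t) = t^{a−1} P(log t) + O(t^{a−1−δ})` as `t → ∞`, for some nonzero polynomial `P`
and some `δ > 0`. -/
theorem tauberian_at_infinity
    (v : ℝ → ℝ) (hv_meas : Measurable v) (hv_nonneg : ∀ x : ℝ, 0 ≤ x → 0 ≤ v x)
    (hv_mono : ∃ T : ℝ, ∀ x y : ℝ, T ≤ x → x ≤ y → v x ≤ v y)
    (σ₀ : ℝ)
    (hconv : ∀ s : ℂ, σ₀ < s.re →
      IntegrableOn (fun x : ℝ => (x : ℂ) ^ (-s) * (v x : ℂ)) (Ioi 0))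
    (F : ℂ → ℂ) (a : ℝ) (b : ℕ) (hb : 0 < b)
    (δ₀ : ℝ) (hδ₀ : 0 < δ₀) (κ : ℝ) (hκ : 0 < κ)
    (hFeq : ∀ s : ℂ, σ₀ < s.re →
      F s = ∫ x in Ioi (0:ℝ), (x : ℂ) ^ (-s) * (v x : ℂ))
    (hF_hol : DifferentiableOn ℂ F {s : ℂ | a - δ₀ < s.re ∧ s ≠ (a : ℂ)})
    (hpole : ∃ H : ℂ → ℂ, AnalyticAt ℂ H (a : ℂ) ∧ H (a : ℂ) ≠ 0 ∧
      ∀ s : ℂ, a - δ₀ < s.re → s ≠ (a : ℂ) → H s = (s - (a : ℂ)) ^ b * F s)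
    (hbound : ∃ Cκ > (0:ℝ), ∀ s : ℂ, a - δ₀ < s.re → s ≠ (a : ℂ) →
      ‖F s * (s - (a : ℂ)) ^ b / s ^ b‖ ≤ Cκ * (1 + |s.im|) ^ κ) :
    ∃ P : Polynomial ℝ, P ≠ 0 ∧ ∃ δ > (0:ℝ), ∃ C > (0:ℝ), ∃ T : ℝ, ∀ t ≥ T,
      |v t - t ^ (a - 1) * P.eval (Real.log t)| ≤ C * t ^ (a - 1 - δ) := by

  obtain ⟨H, hHa, hHne, hH⟩ := hpole
  obtain ⟨Cκ, hCκ, hbd⟩ := hbound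
  obtain ⟨T, hT⟩ := hv_mono
  obtain ⟨φ, hφ, hφc, h0, h1, h2⟩ := exists_bump
  have hHd := H_diffOn F H a b δ₀ hF_hol hHa hH
  have hDo : IsOpen {s : ℂ | a - δ₀ < s.re} := isOpen_lt continuous_const Complex.continuous_re
  obtain ⟨h, G, hG, hHG⟩ := taylor_div {s : ℂ | a - δ₀ < s.re} (a : ℂ)
    (hDo.mem_nhds (show a - δ₀ < (a:ℂ).re by rw [Complex.ofReal_re]; linarith)) H hHd b
  have hFG : ∀ s : ℂ, a - δ₀ < s.re → s ≠ (a : ℂ) →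
      F s = (∑ k ∈ Finset.range b, h k * (s - a) ^ k / (s - a) ^ b) + G s := by
    intro s hs hsa
    have hne : (s - (a:ℂ)) ^ b ≠ 0 := pow_ne_zero _ (sub_ne_zero.2 hsa)
    have e := hHG s
    rw [hH s hs hsa] at e
    rw [← Finset.sum_div]
    field_simp
    linear_combination e
  set c₁ := a - δ₀ / 2 with hc₁
  set c := max σ₀ a + 1 with hc
  have hcσ : σ₀ < c := by rw [hc]; linarith [le_max_left σ₀ a]
  have hca : a < c := by rw [hc]; linarith [le_max_right σ₀ a]
  obtain ⟨B, hB, hGB⟩ := G_bound F G a b δ₀ κ Cκ c₁ c hκ hCκ (by rw [hc₁]; linarith) h hG hFG hbd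
  set V : ℝ → ℂ := fun x => (v x : ℂ) - mainR a b h x with hV
  have hvI : ∀ s : ℂ, s.re = c →
      IntegrableOn (fun x : ℝ => cexp (-s * Real.log x) * (v x : ℂ)) (Ioi 0) := fun s hs =>
    (hconv s (by rw [hs]; exact hcσ)).congr_fun
      (fun x hx => by simp only [exp_log_eq x hx]) measurableSet_Ioi
  have hVe : ∀ s : ℂ, (fun x : ℝ => cexp (-s * Real.log x) * V x) =
      fun x : ℝ => cexp (-s * Real.log x) * (v x : ℂ) - cexp (-s * Real.log x) * mainR a b h x := by
    intro s; funext x; simp only [hV]; ring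
  have hVI : IntegrableOn (fun x : ℝ => cexp (-c * Real.log x) * V x) (Ioi 0) := by
    rw [hVe]
    exact (hvI c (by simp)).sub (mainR_transform a b h c (by simpa using hca)).1
  have hGV : ∀ s : ℂ, s.re = c → G s = ∫ x in Ioi (0:ℝ), cexp (-s * Real.log x) * V x := by
    intro s hs
    have hsa : a < s.re := by rw [hs]; exact hca
    obtain ⟨m1, m2⟩ := mainR_transform a b h s hsa
    have e1 : F s = ∫ x in Ioi (0:ℝ), cexp (-s * Real.log x) * (v x : ℂ) := by
      rw [hFeq s (by rw [hs]; exact hcσ)]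
      exact setIntegral_congr_fun measurableSet_Ioi fun x hx => by simp only [exp_log_eq x hx]
    rw [hVe, integral_sub (hvI s hs) m1, m2, ← e1,
      hFG s (by linarith) (by rintro rfl; simp at hsa)]
    ring
  obtain ⟨C₀, N, hC₀, hsm⟩ := smoothed_bound φ hφ hφc h0 V c₁ c κ B (by rw [hc₁]; linarith) hB
    hVI G (hG.mono fun s hs => by
      have : c₁ ≤ s.re := hs.1
      show a - δ₀ < s.re
      rw [hc₁] at this; linarith) hGV hGB
  obtain ⟨δ, hδ, C, hC, T', hfin⟩ := desmooth φ h0 h1 h2 v T hT (mainP b h) a V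
    (fun x hx => by
      rw [← mainR_re a b h x hx]; simp [hV]) (δ₀ / 2) (by linarith) C₀ hC₀ N hsm
  refine ⟨mainP b h, ?_, δ, hδ, C, hC, T', hfin⟩
  intro hP
  apply hHne
  refine no_small v hv_meas hv_nonneg σ₀ hconv F H a b hb δ₀ hδ₀ hFeq hHd hH δ C T' hδ ?_
  intro t ht
  have := hfin t ht
  rw [hP] at this
  simpa using this
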